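/- Let C be a Hopf algebra over a field k, and let A be a right C-comodule algebra that is injective as a right C-comodule with A^{coC} = k (e.g. A part of a Galois extension over k). Then the map α : A ⊗ A → A ⊗ C, α(a ⊗ a') = a a'₍₀₎ ⊗ a'₍₁₎, is surjective if and only if the induced map β : A ⊗_{A^{coC}} A → A ⊗ C is bijective. -/

import Mathlib

open scoped TensorProduct

section

variable (k : Type) [Field k]
variable (C : Type) [Ring C] [HopfAlgebra k C]
variable (A : Type) [CommRing A] [Algebra k A]

/-- The map `a ↦ a ⊗ 1 : A → A ⊗ C`. -/
noncomputable def incOne : A →ₗ[k] A ⊗[k] C :=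
  (TensorProduct.mk k A C).flip 1

/-- The canonical map `α : A ⊗ A → A ⊗ C`, `a ⊗ a' ↦ a a'₍₀₎ ⊗ a'₍₁₎`. -/
noncomputable def alphaMap (ρ : A →ₐ[k] A ⊗[k] C) : A ⊗[k] A →ₗ[k] A ⊗[k] C :=
  (LinearMap.mul' k (A ⊗[k] C)) ∘ₗ (TensorProduct.map (incOne k C A) ρ.toLinearMap)

section helpers

open Coalgebra HopfAlgebra

variable {k : Type} [Field k] {A : Type} [CommRing A] [Algebra k A]

@[simp]
lemma alphaMap_tmul {C : Type} [Ring C] [HopfAlgebra k C] (ρ : A →ₐ[k] A ⊗[k] C) (x y : A) :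
    alphaMap k C A ρ (x ⊗ₜ y) = x ⊗ₜ 1 * ρ y := by
  simp [alphaMap, incOne]

lemma tmul_one_mul_comm {C : Type} [Ring C] [Algebra k C] (x : A) (w : A ⊗[k] C) :
    x ⊗ₜ 1 * w = w * x ⊗ₜ 1 := by
  induction w with
  | zero => simp
  | tmul a c => simp [mul_comm]
  | add u v hu hv => simp [mul_add, add_mul, hu, hv]

section Antipode

variable {C : Type} [Ring C] [HopfAlgebra k C]

lemma sum_antipode_tmul_one_mul_comul {ι : Type*} {c : C} (repr : Repr k c ι) :
    ∑ i ∈ repr.index, (antipode k (repr.left i) ⊗ₜ[k] (1 : C)) * comul (R := k) (repr.right i) =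
      1 ⊗ₜ c := by
  have h := congr(TensorProduct.map (LinearMap.mul' k C ∘ₗ (antipode k).rTensor C) LinearMap.id
    ((TensorProduct.assoc k C C C).symm $(sum_tmul_tmul_eq repr (fun i => ℛ k (repr.left i))
      (fun i => ℛ k (repr.right i)))))
  simp only [map_sum, TensorProduct.assoc_symm_tmul, TensorProduct.map_tmul,
    LinearMap.comp_apply, LinearMap.rTensor_tmul, LinearMap.mul'_apply, LinearMap.id_apply,
    ← TensorProduct.sum_tmul, sum_antipode_mul_eq_smul, TensorProduct.smul_tmul,
    ← TensorProduct.tmul_sum, sum_counit_smul] at h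
  rw [h]
  refine Finset.sum_congr rfl fun i _ => ?_
  conv_lhs => rw [← (ℛ k (repr.right i)).eq]
  simp [Finset.mul_sum, TensorProduct.tmul_sum]

lemma sum_one_tmul_mul_comul_antipode {ι : Type*} {c : C} (repr : Repr k c ι) :
    ∑ i ∈ repr.index, ((1 : C) ⊗ₜ[k] repr.left i) * comul (R := k) (antipode k (repr.right i)) =
      antipode k c ⊗ₜ 1 := by
  have h := congr((LinearMap.mul' k (C ⊗[k] C) ∘ₗ (LinearMap.mul' k (C ⊗[k] C)).lTensor _)
    $(sum_map_tmul_tmul_eq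
      ((TensorProduct.mk k C C).flip 1 ∘ₗ antipode k) (comul (R := k))
      (comul (R := k) ∘ₗ antipode k) c (repr := repr)
      (a₁ := fun i => ℛ k (repr.left i)) (a₂ := fun i => ℛ k (repr.right i))))
  simp only [map_sum, LinearMap.comp_apply, LinearMap.lTensor_tmul, LinearMap.mul'_apply,
    LinearMap.flip_apply, TensorProduct.mk_apply, ← mul_assoc, ← Finset.sum_mul,
    sum_antipode_tmul_one_mul_comul] at h
  rw [← h]
  simp only [mul_assoc, ← Bialgebra.comul_mul, ← Finset.mul_sum, ← map_sum,
    sum_mul_antipode_eq_smul]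
  simp only [map_smul, Bialgebra.comul_one, mul_smul_comm, mul_one, TensorProduct.smul_tmul',
    ← TensorProduct.sum_tmul]
  have h' : ∑ i ∈ repr.index, counit (R := k) (repr.right i) • repr.left i = c := by
    have := congr(TensorProduct.rid k C $(sum_tmul_counit_eq repr))
    simpa only [map_sum, TensorProduct.rid_tmul, one_smul] using this
  conv_rhs => rw [← h', map_sum]
  simp only [map_smul]

end Antipode

/-- The twisted multiplication `a ⊗ c ↦ a φ(S c)`; precomposed with the coaction, it is the trace
attached to the total integral `φ`. -/
noncomputable def integralAction {C : Type} [Ring C] [HopfAlgebra k C] (φ : C →ₗ[k] A) :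
    A ⊗[k] C →ₗ[k] A :=
  LinearMap.mul' k A ∘ₗ (φ ∘ₗ antipode k).lTensor A

@[simp]
lemma integralAction_tmul {C : Type} [Ring C] [HopfAlgebra k C] (φ : C →ₗ[k] A) (a : A) (c : C) :
    integralAction φ (a ⊗ₜ c) = a * φ (antipode k c) := by
  simp [integralAction]

lemma integralAction_tmul_one_mul {C : Type} [Ring C] [HopfAlgebra k C] (φ : C →ₗ[k] A) (a : A)
    (w : A ⊗[k] C) : integralAction φ (a ⊗ₜ 1 * w) = a * integralAction φ w := by
  induction w with
  | zero => simp
  | tmul b c => simp [mul_assoc]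
  | add u v hu hv => simp only [mul_add, map_add, hu, hv]

/-- The trace attached to a colinear map takes values in the coinvariants. -/
lemma coaction_integralAction_coaction {C : Type} [Ring C] [HopfAlgebra k C]
    {ρ : A →ₐ[k] A ⊗[k] C}
    (hρ : ∀ a, ρ.toLinearMap.rTensor C (ρ a) =
      (TensorProduct.assoc k A C C).symm ((comul (R := k)).lTensor A (ρ a)))
    {φ : C →ₗ[k] A} (hφ : ∀ c, ρ (φ c) = φ.rTensor C (comul (R := k) c)) (y : A) :
    ρ (integralAction φ (ρ y)) = integralAction φ (ρ y) ⊗ₜ 1 := by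
  let F : (A ⊗[k] C) ⊗[k] C →ₗ[k] A ⊗[k] C :=
    LinearMap.mul' k (A ⊗[k] C) ∘ₗ (ρ.toLinearMap ∘ₗ φ ∘ₗ antipode k).lTensor (A ⊗[k] C)
  have hF (z : A ⊗[k] C) (c : C) : F (z ⊗ₜ c) = z * ρ (φ (antipode k c)) := by simp [F]
  have h₁ (w : A ⊗[k] C) : ρ (integralAction φ w) = F (ρ.toLinearMap.rTensor C w) := by
    induction w with
    | zero => simp
    | tmul a c => simp [hF]
    | add u v hu hv => simp only [map_add, hu, hv]
  have hmul (a : A) (c : C) (u : C ⊗[k] C) :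
      a ⊗ₜ c * φ.rTensor C u = a ⊗ₜ 1 * φ.rTensor C (1 ⊗ₜ c * u) := by
    induction u with
    | zero => simp
    | tmul d e => simp
    | add u v hu hv => simp only [mul_add, map_add, hu, hv]
  have h₂ (w : A ⊗[k] C) :
      F ((TensorProduct.assoc k A C C).symm ((comul (R := k)).lTensor A w)) =
        integralAction φ w ⊗ₜ 1 := by
    induction w with
    | zero => simp
    | tmul a c =>
      rw [LinearMap.lTensor_tmul, ← (ℛ k c).eq]
      simp only [TensorProduct.tmul_sum, map_sum, TensorProduct.assoc_symm_tmul, hF, hφ]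
      rw [Finset.sum_congr rfl fun i _ => hmul a _ _]
      simp only [← Finset.mul_sum, ← map_sum, sum_one_tmul_mul_comul_antipode]
      simp
    | add u v hu hv => simp only [map_add, hu, hv, TensorProduct.add_tmul]
  rw [h₁, hρ, h₂]

/-- A surjective canonical map is injective when the coinvariants
are trivial and a total integral exists. -/
lemma alphaMap_injective_of_surjective {C : Type} [Ring C] [HopfAlgebra k C]
    {ρ : A →ₐ[k] A ⊗[k] C}
    (hcounit : ∀ a, TensorProduct.rid k A ((counit (R := k)).lTensor A (ρ a)) = a)
    (hρ : ∀ a, ρ.toLinearMap.rTensor C (ρ a) =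
      (TensorProduct.assoc k A C C).symm ((comul (R := k)).lTensor A (ρ a)))
    {φ : C →ₗ[k] A} (hφ : ∀ c, ρ (φ c) = φ.rTensor C (comul (R := k) c)) (hφ1 : φ 1 = 1)
    (htriv : ∀ a : A, ρ a = a ⊗ₜ[k] 1 → ∃ c : k, a = algebraMap k A c)
    (hα : Function.Surjective (alphaMap k C A ρ)) :
    Function.Injective (alphaMap k C A ρ) := by
  obtain ⟨s, hs⟩ := (alphaMap k C A ρ).exists_rightInverse_of_surjective
    (LinearMap.range_eq_top.2 hα)
  replace hs (w : A ⊗[k] C) : alphaMap k C A ρ (s w) = w := LinearMap.congr_fun hs w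
  -- `N (z ⊗ (p ⊗ q)) = θ(z ρ(q)) ⊗ p`, where `θ = integralAction φ`
  let N : (A ⊗[k] C) ⊗[k] (A ⊗[k] A) →ₗ[k] A ⊗[k] A :=
    (integralAction φ ∘ₗ LinearMap.mul' k (A ⊗[k] C)).rTensor A ∘ₗ
      (TensorProduct.assoc k (A ⊗[k] C) (A ⊗[k] C) A).symm.toLinearMap ∘ₗ
      ((TensorProduct.comm k A (A ⊗[k] C)).toLinearMap ∘ₗ
        ρ.toLinearMap.lTensor A).lTensor (A ⊗[k] C)
  have hN (z : A ⊗[k] C) (p q : A) :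
      N (z ⊗ₜ (p ⊗ₜ q)) = integralAction φ (z * ρ q) ⊗ₜ p := by simp [N]
  have hNα (x y : A) (u : A ⊗[k] A) : N ((x ⊗ₜ 1 * ρ y) ⊗ₜ u) =
      x ⊗ₜ integralAction φ (ρ y * alphaMap k C A ρ u) := by
    induction u with
    | zero => simp
    | add u v hu hv => simp only [map_add, TensorProduct.tmul_add, mul_add, hu, hv]
    | tmul p q =>
      obtain ⟨c, hc⟩ := htriv _ (coaction_integralAction_coaction hρ hφ (y * q))
      rw [hN, alphaMap_tmul, mul_assoc, ← mul_assoc (ρ y), ← tmul_one_mul_comm,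
        mul_assoc (p ⊗ₜ 1), ← map_mul,
        integralAction_tmul_one_mul, integralAction_tmul_one_mul, hc, mul_comm x, mul_comm p,
        ← Algebra.smul_def, ← Algebra.smul_def, TensorProduct.smul_tmul]
  let G : (A ⊗[k] C) ⊗[k] C →ₗ[k] A ⊗[k] A :=
    N ∘ₗ (s ∘ₗ TensorProduct.mk k A C 1 ∘ₗ antipode k).lTensor (A ⊗[k] C)
  let Ψ : (A ⊗[k] C) ⊗[k] C →ₗ[k] A :=
    integralAction φ ∘ₗ LinearMap.mul' k (A ⊗[k] C) ∘ₗ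
      (TensorProduct.mk k A C 1 ∘ₗ antipode k).lTensor (A ⊗[k] C)
  have hG (x : A) (w : A ⊗[k] C) :
      G ((x ⊗ₜ 1) ⊗ₜ 1 * ρ.toLinearMap.rTensor C w) = x ⊗ₜ Ψ (ρ.toLinearMap.rTensor C w) := by
    induction w with
    | zero => simp
    | add u v hu hv => simp only [map_add, mul_add, TensorProduct.tmul_add, hu, hv]
    | tmul y c => simp [G, Ψ, hNα, hs]
  have hΨ (w : A ⊗[k] C) :
      Ψ ((TensorProduct.assoc k A C C).symm ((comul (R := k)).lTensor A w)) =
        TensorProduct.rid k A ((counit (R := k)).lTensor A w) := by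
    induction w with
    | zero => simp
    | add u v hu hv => simp only [map_add, hu, hv]
    | tmul a c =>
      rw [LinearMap.lTensor_tmul, ← (ℛ k c).eq]
      simp only [TensorProduct.tmul_sum, map_sum, TensorProduct.assoc_symm_tmul]
      simp only [Ψ, LinearMap.comp_apply, LinearMap.lTensor_tmul, LinearMap.mul'_apply,
        TensorProduct.mk_apply, Algebra.TensorProduct.tmul_mul_tmul, mul_one,
        integralAction_tmul, ← Finset.mul_sum, ← map_sum, sum_mul_antipode_eq_smul]
      simp [hφ1]
  have hcomul (x : A) (w : A ⊗[k] C) :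
      (TensorProduct.assoc k A C C).symm ((comul (R := k)).lTensor A (x ⊗ₜ 1 * w)) =
        (x ⊗ₜ 1) ⊗ₜ 1 *
          (TensorProduct.assoc k A C C).symm ((comul (R := k)).lTensor A w) := by
    induction w with
    | zero => simp
    | add u v hu hv => simp only [map_add, mul_add, hu, hv]
    | tmul a c =>
      simp only [Algebra.TensorProduct.tmul_mul_tmul, one_mul, LinearMap.lTensor_tmul]
      rw [← (ℛ k c).eq]
      simp [TensorProduct.tmul_sum, Finset.mul_sum]
  refine Function.LeftInverse.injective (g := fun w =>
    G ((TensorProduct.assoc k A C C).symm ((comul (R := k)).lTensor A w))) fun u => ?_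
  induction u with
  | zero => simp
  | add u v hu hv => simp only [map_add] at hu hv ⊢; rw [hu, hv]
  | tmul x y =>
    simp only [alphaMap_tmul]
    rw [hcomul, ← hρ, hG, hρ, hΨ, hcounit]

end helpers

/-- Let `C` be a Hopf algebra and `A` a commutative right `C`-comodule
algebra that is injective as a `C`-comodule and has trivial coinvariants
`A^{coC} = k`.  Then the map `α : A ⊗ A → A ⊗ C`, `α(a ⊗ a') = a a'₍₀₎ ⊗ a'₍₁₎`, is
surjective iff the induced map `β : A ⊗_{A^{coC}} A = A ⊗ A → A ⊗ C` is bijective. -/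
theorem alpha_surjective_iff_beta_bijective
    (ρ : A →ₐ[k] A ⊗[k] C)
    (hcounit : ∀ a : A,
      (TensorProduct.rid k A) ((LinearMap.lTensor A (Coalgebra.counit)) (ρ a)) = a)
    (hcoassoc : (LinearMap.lTensor A Coalgebra.comul) ∘ₗ ρ.toLinearMap =
      (TensorProduct.assoc k A C C).toLinearMap ∘ₗ (LinearMap.rTensor C ρ.toLinearMap)
        ∘ₗ ρ.toLinearMap)
    (hinj : ∃ σ : A ⊗[k] C →ₗ[k] A,
      σ ∘ₗ ρ.toLinearMap = LinearMap.id ∧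
      ρ.toLinearMap ∘ₗ σ = (LinearMap.rTensor C σ) ∘ₗ
        (TensorProduct.assoc k A C C).symm.toLinearMap ∘ₗ
        (LinearMap.lTensor A Coalgebra.comul))
    (htriv : ∀ a : A, ρ a = a ⊗ₜ[k] 1 → ∃ c : k, a = algebraMap k A c) :
    Function.Surjective (alphaMap k C A ρ) ↔ Function.Bijective (alphaMap k C A ρ) := by
  refine ⟨fun hα => ⟨?_, hα⟩, fun h => h.2⟩
  obtain ⟨σ, hσ, hσρ⟩ := hinj
  have hρ (a : A) : ρ.toLinearMap.rTensor C (ρ a) = (TensorProduct.assoc k A C C).symm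
      ((Coalgebra.comul (R := k)).lTensor A (ρ a)) := by
    rw [LinearEquiv.eq_symm_apply]
    exact (LinearMap.congr_fun hcoassoc a).symm
  have hφ (c : C) : ρ ((σ ∘ₗ TensorProduct.mk k A C 1) c) =
      (σ ∘ₗ TensorProduct.mk k A C 1).rTensor C (Coalgebra.comul (R := k) c) := by
    have h := LinearMap.congr_fun hσρ (1 ⊗ₜ c)
    simp only [LinearMap.comp_apply, LinearMap.lTensor_tmul] at h
    refine h.trans ?_
    generalize Coalgebra.comul (R := k) c = u
    induction u with
    | zero => simp
    | tmul d e => simp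
    | add u v hu hv => simp only [TensorProduct.tmul_add, map_add, hu, hv]
  have hφ1 : (σ ∘ₗ TensorProduct.mk k A C 1) 1 = 1 := by
    simpa [Algebra.TensorProduct.one_def] using LinearMap.congr_fun hσ 1
  exact alphaMap_injective_of_surjective hcounit hρ hφ hφ1 htriv hα

end
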